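/- arXiv:2507.21576 — 4 statements merged into one kernel-verified Lean document; each statement's English description precedes it below -/
import Mathlib

section
/- Let Γ ⊆ ℝ^m with 0 ∈ Γ, and let δ, L, K, M > 0 and p ≥ 1. There exists a constant c' > 0, depending only on δ, L, K, M, p, with the following property: for every triple of functions f : Γ → ℝ, b : Γ → ℝ, σ : Γ → ℝ^n satisfying f(v) ≥ 0 and max{ b(v)², ‖σ(v)‖² } ≤ δ f(v) + L for all v ∈ Γ, and f(0) ≤ K; for every P ∈ [0, M] and Λ ∈ ℝ^n; and for every v ∈ Γ with max{ |b(v)|, ‖σ(v)‖ } > c' (1 + ‖Λ‖), one has G(v, P, Λ) > G(0, P, Λ), where G(v, P, Λ) := f(v) + (1/2) p (p−1) P ‖σ(v)‖² + p P b(v) + p ⟨Λ, σ(v)⟩. Consequently, any minimizer v̂ of v ↦ G(v, P, Λ) over Γ satisfies max{ |b(v̂)|, ‖σ(v̂)‖ } ≤ c' (1 + ‖Λ‖). -/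
open RealInnerProductSpace

/-- The linear growth of the lower-order terms of the Hamiltonian. -/
lemma abs_lower_order_le {n : ℕ} {p P M b X : ℝ} {s Λ : EuclideanSpace ℝ (Fin n)}
    (hp : 0 ≤ p) (hP : 0 ≤ P) (hPM : P ≤ M) (hb : |b| ≤ X) (hs : ‖s‖ ≤ X) :
    |p * P * b + p * ⟪Λ, s⟫| ≤ p * (M + 1) * (1 + ‖Λ‖) * X := by
  have hX : 0 ≤ X := (abs_nonneg b).trans hb
  have hM : 0 ≤ M := hP.trans hPM
  have h1 : |P * b| ≤ M * X := by
    rw [abs_mul, abs_of_nonneg hP]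
    gcongr
  have h2 : |⟪Λ, s⟫| ≤ ‖Λ‖ * X := (abs_real_inner_le_norm Λ s).trans (by gcongr)
  have h3 : |P * b + ⟪Λ, s⟫| ≤ (M + 1) * (1 + ‖Λ‖) * X := by
    refine (abs_add_le _ _).trans ?_
    have h4 : 0 ≤ M * ‖Λ‖ * X := by positivity
    nlinarith
  calc |p * P * b + p * ⟪Λ, s⟫| = p * |P * b + ⟪Λ, s⟫| := by
        rw [← abs_of_nonneg hp, ← abs_mul, abs_of_nonneg hp]
        congr 1
        ring
    _ ≤ p * ((M + 1) * (1 + ‖Λ‖) * X) := by gcongr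
    _ = p * (M + 1) * (1 + ‖Λ‖) * X := by ring

/-- in the standard case (`max{b(v)², ‖σ(v)‖²} ≤ δ f(v) + L`,
`f ≥ 0` on `Γ`, `f(0) ≤ K`, `0 ≤ P ≤ M`, `p ≥ 1`), there is a constant `c' > 0`
depending only on `δ, L, K, M, p` such that the Hamiltonian
`G(v,P,Λ) = f(v) + ½p(p−1)P‖σ(v)‖² + pPb(v) + p⟨Λ,σ(v)⟩` satisfies
`G(v,P,Λ) > G(0,P,Λ)` whenever `max{|b(v)|, ‖σ(v)‖} > c'(1+‖Λ‖)`; consequently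
any minimizer `v̂` of `G(·,P,Λ)` over `Γ` satisfies `max{|b(v̂)|,‖σ(v̂)‖} ≤ c'(1+‖Λ‖)`. -/
theorem standard_case_minimizer_bound {m n : ℕ}
    (Γ : Set (EuclideanSpace ℝ (Fin m))) (h0 : (0 : EuclideanSpace ℝ (Fin m)) ∈ Γ)
    (δ L K M p : ℝ) (hδ : 0 < δ) (hL : 0 < L) (hK : 0 < K) (hM : 0 < M) (hp : 1 ≤ p) :
    ∃ c' : ℝ, 0 < c' ∧
      ∀ (f b : EuclideanSpace ℝ (Fin m) → ℝ)
        (σ : EuclideanSpace ℝ (Fin m) → EuclideanSpace ℝ (Fin n)),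
        (∀ v ∈ Γ, 0 ≤ f v) →
        (∀ v ∈ Γ, max ((b v) ^ 2) (‖σ v‖ ^ 2) ≤ δ * f v + L) →
        f 0 ≤ K →
        ∀ P : ℝ, 0 ≤ P → P ≤ M →
        ∀ Λ : EuclideanSpace ℝ (Fin n),
          (∀ v ∈ Γ, c' * (1 + ‖Λ‖) < max |b v| ‖σ v‖ →
            f 0 + (1 / 2) * p * (p - 1) * P * ‖σ 0‖ ^ 2 + p * P * b 0 + p * ⟪Λ, σ 0⟫
              < f v + (1 / 2) * p * (p - 1) * P * ‖σ v‖ ^ 2 + p * P * b v + p * ⟪Λ, σ v⟫) ∧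
          (∀ vhat ∈ Γ,
            (∀ v ∈ Γ,
              f vhat + (1 / 2) * p * (p - 1) * P * ‖σ vhat‖ ^ 2 + p * P * b vhat
                  + p * ⟪Λ, σ vhat⟫
                ≤ f v + (1 / 2) * p * (p - 1) * P * ‖σ v‖ ^ 2 + p * P * b v + p * ⟪Λ, σ v⟫) →
            max |b vhat| ‖σ vhat‖ ≤ c' * (1 + ‖Λ‖)) := by
  have hp0 : 0 ≤ p := by linarith
  have hp1 : 0 ≤ p - 1 := by linarith
  obtain ⟨D, hD⟩ : ∃ D, D = δ * K + L := ⟨_, rfl⟩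
  have hD0 : 0 < D := by rw [hD]; positivity
  obtain ⟨C, hC⟩ : ∃ C, C = K + (1 / 2) * p * (p - 1) * M * D + p * (M + 1) * (D + 1) :=
    ⟨_, rfl⟩
  have hC0 : 0 < C := by rw [hC]; positivity
  refine ⟨δ * (p * (M + 1)) + (L + δ * C) + 1, by positivity, ?_⟩
  intro f b σ hf hgrowth hf0 P hP hPM Λ
  have key : ∀ v ∈ Γ, (δ * (p * (M + 1)) + (L + δ * C) + 1) * (1 + ‖Λ‖) < max |b v| ‖σ v‖ →
      f 0 + (1 / 2) * p * (p - 1) * P * ‖σ 0‖ ^ 2 + p * P * b 0 + p * ⟪Λ, σ 0⟫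
        < f v + (1 / 2) * p * (p - 1) * P * ‖σ v‖ ^ 2 + p * P * b v + p * ⟪Λ, σ v⟫ := by
    intro v hv hlarge
    have hΛ := norm_nonneg Λ
    obtain ⟨t, ht⟩ : ∃ t, t = 1 + ‖Λ‖ := ⟨_, rfl⟩
    have ht1 : 1 ≤ t := by linarith
    obtain ⟨X, hX⟩ : ∃ X, X = max |b v| ‖σ v‖ := ⟨_, rfl⟩
    have hXsq : X ^ 2 ≤ δ * f v + L := by
      refine le_trans ?_ (hgrowth v hv)
      rcases max_choice |b v| ‖σ v‖ with h | h
      · rw [hX, h, sq_abs]; exact le_max_left _ _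
      · rw [hX, h]; exact le_max_right _ _
    have hlow := abs_lower_order_le (Λ := Λ) hp0 hP hPM
      (hX ▸ le_max_left |b v| ‖σ v‖) (hX ▸ le_max_right |b v| ‖σ v‖)
    have hD1 : max ((b 0) ^ 2) (‖σ 0‖ ^ 2) ≤ D := by
      refine (hgrowth 0 h0).trans ?_
      rw [hD]
      gcongr
    have hb0 : |b 0| ≤ D + 1 :=
      abs_le_of_sq_le_sq (by nlinarith [(le_max_left _ _).trans hD1]) (by positivity)
    have hs0 : ‖σ 0‖ ≤ D + 1 :=
      le_of_abs_le <| abs_le_of_sq_le_sq (by nlinarith [(le_max_right _ _).trans hD1]) (by positivity)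
    have hup := abs_lower_order_le (Λ := Λ) hp0 hP hPM hb0 hs0
    rw [← ht, ← hX] at hlarge
    rw [← ht] at hlow hup
    have hquad0 : (1 / 2) * p * (p - 1) * P * ‖σ 0‖ ^ 2 ≤ (1 / 2) * p * (p - 1) * M * D := by
      have := (le_max_right _ _).trans hD1
      gcongr
    have hquadv : 0 ≤ (1 / 2) * p * (p - 1) * P * ‖σ v‖ ^ 2 := by positivity
    have hG0 : f 0 + (1 / 2) * p * (p - 1) * P * ‖σ 0‖ ^ 2 + (p * P * b 0 + p * ⟪Λ, σ 0⟫)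
        ≤ C * t := by
      have h1 : 0 ≤ (K + (1 / 2) * p * (p - 1) * M * D) * (t - 1) :=
        mul_nonneg (by positivity) (by linarith)
      rw [hC]
      linarith [le_abs_self (p * P * b 0 + p * ⟪Λ, σ 0⟫)]
    have hXt : t ≤ X := by
      have : 0 ≤ (δ * (p * (M + 1)) + (L + δ * C)) * t := by positivity
      linarith
    have hX1 : 1 ≤ X := ht1.trans hXt
    have hXX : (δ * (p * (M + 1)) + (L + δ * C) + 1) * t * X < X * X := by gcongr
    have h2 : 0 ≤ (L + δ * C) * t * (X - 1) := mul_nonneg (by positivity) (by linarith)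
    have h3 : 0 ≤ L * (t - 1) := mul_nonneg hL.le (by linarith)
    have h4 : 0 ≤ t * X := by positivity
    have h5 : δ * (p * (M + 1) * t * X + C * t) < δ * f v := by linarith
    have h6 := lt_of_mul_lt_mul_left h5 hδ.le
    linarith [neg_abs_le (p * P * b v + p * ⟪Λ, σ v⟫)]
  refine ⟨key, fun vhat hvhat hmin => ?_⟩
  by_contra! h
  exact absurd (hmin 0 h0) (not_le.mpr (key vhat hvhat h))
end

section
/- Let Γ ⊆ ℝ^m with 0 ∈ Γ, let p ≥ 1, K > 0, M > 0, L > 0, and let L' ≥ 0 be a constant such that the following holds for the data: f : Γ → ℝ, b : Γ → ℝ, σ : Γ → ℝ^n satisfy f(v) ≥ 0 and ‖σ(v)‖ ≤ L for all v ∈ Γ, f(0) ≤ K, and |b(v)| ≤ (1/(2pM)) f(v) + L' for all v ∈ Γ. Then there exists a constant c' > 0, depending only on p, K, M, L, L', such that for every P ∈ [0, M], every Λ ∈ ℝ^n and every v ∈ Γ with f(v) > c' (1 + ‖Λ‖), one has G(v, P, Λ) > G(0, P, Λ), where G(v, P, Λ) := f(v) + (1/2) p (p−1) P ‖σ(v)‖²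 + p P b(v) + p ⟨Λ, σ(v)⟩. Consequently, any minimizer v̂ of v ↦ G(v, P, Λ) over Γ satisfies f(v̂) ≤ c' (1 + ‖Λ‖). -/
open RealInnerProductSpace

/-- Under the growth bound `|b| ≤ f / (2pM) + L'` and `0 ≤ P ≤ M`, the drift term `pPb` is
dominated by half of the cost, up to a constant. -/
lemma abs_drift_le {p M L' P b f : ℝ} (hp : 0 < p) (hM : 0 < M) (hP : 0 ≤ P) (hPM : P ≤ M)
    (hb : |b| ≤ (1 / (2 * p * M)) * f + L') :
    |p * P * b| ≤ f / 2 + p * M * L' := by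
  calc |p * P * b| = p * P * |b| := by rw [abs_mul, abs_of_nonneg (by positivity)]
    _ ≤ p * M * |b| := by gcongr
    _ ≤ p * M * ((1 / (2 * p * M)) * f + L') := by gcongr
    _ = f / 2 + p * M * L' := by field_simp

/-- A bounded diffusion coefficient contributes at most linearly in the adjoint variable. -/
lemma abs_mul_inner_le {E : Type*} [NormedAddCommGroup E] [InnerProductSpace ℝ E]
    {p L : ℝ} (hp : 0 ≤ p) (x y : E) (hy : ‖y‖ ≤ L) :
    |p * ⟪x, y⟫| ≤ p * L * ‖x‖ := by
  calc |p * ⟪x, y⟫| = p * |⟪x, y⟫| := by rw [abs_mul, abs_of_nonneg hp]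
    _ ≤ p * (‖x‖ * ‖y‖) := by gcongr; exact abs_real_inner_le_norm x y
    _ ≤ p * (‖x‖ * L) := by gcongr
    _ = p * L * ‖x‖ := by ring

/-- in the second case (`‖σ(v)‖ ≤ L`, `f ≥ 0` on `Γ`, `f(0) ≤ K`,
`|b(v)| ≤ (1/(2pM)) f(v) + L'`, `0 ≤ P ≤ M`, `p ≥ 1`), there is a constant
`c' > 0` depending only on `p, K, M, L, L'` such that the Hamiltonian
`G(v,P,Λ) = f(v) + ½p(p−1)P‖σ(v)‖² + pPb(v) + p⟨Λ,σ(v)⟩` satisfies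
`G(v,P,Λ) > G(0,P,Λ)` whenever `f(v) > c'(1+‖Λ‖)`; consequently any minimizer
`v̂` of `G(·,P,Λ)` over `Γ` satisfies `f(v̂) ≤ c'(1+‖Λ‖)`. -/
theorem second_case_minimizer_bound {m n : ℕ}
    (Γ : Set (EuclideanSpace ℝ (Fin m))) (h0 : (0 : EuclideanSpace ℝ (Fin m)) ∈ Γ)
    (p K M L L' : ℝ) (hp : 1 ≤ p) (hK : 0 < K) (hM : 0 < M) (hL : 0 < L) (hL' : 0 ≤ L') :
    ∃ c' : ℝ, 0 < c' ∧
      ∀ (f b : EuclideanSpace ℝ (Fin m) → ℝ)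
        (σ : EuclideanSpace ℝ (Fin m) → EuclideanSpace ℝ (Fin n)),
        (∀ v ∈ Γ, 0 ≤ f v) →
        (∀ v ∈ Γ, ‖σ v‖ ≤ L) →
        f 0 ≤ K →
        (∀ v ∈ Γ, |b v| ≤ (1 / (2 * p * M)) * f v + L') →
        ∀ P : ℝ, 0 ≤ P → P ≤ M →
        ∀ Λ : EuclideanSpace ℝ (Fin n),
          (∀ v ∈ Γ, c' * (1 + ‖Λ‖) < f v →
            f 0 + (1 / 2) * p * (p - 1) * P * ‖σ 0‖ ^ 2 + p * P * b 0 + p * ⟪Λ, σ 0⟫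
              < f v + (1 / 2) * p * (p - 1) * P * ‖σ v‖ ^ 2 + p * P * b v + p * ⟪Λ, σ v⟫) ∧
          (∀ vhat ∈ Γ,
            (∀ v ∈ Γ,
              f vhat + (1 / 2) * p * (p - 1) * P * ‖σ vhat‖ ^ 2 + p * P * b vhat
                  + p * ⟪Λ, σ vhat⟫
                ≤ f v + (1 / 2) * p * (p - 1) * P * ‖σ v‖ ^ 2 + p * P * b v + p * ⟪Λ, σ v⟫) →
            f vhat ≤ c' * (1 + ‖Λ‖)) := by
  have hp0 : 0 < p := by linarith
  have hp1 : 0 ≤ p - 1 := by linarith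
  refine ⟨3 * K + p * (p - 1) * M * L ^ 2 + 4 * (p * M * L') + 4 * (p * L), by positivity, ?_⟩
  intro f b σ _ hσ hf0 hb P hP hPM Λ
  have key : ∀ v ∈ Γ,
      (3 * K + p * (p - 1) * M * L ^ 2 + 4 * (p * M * L') + 4 * (p * L)) * (1 + ‖Λ‖) < f v →
      f 0 + (1 / 2) * p * (p - 1) * P * ‖σ 0‖ ^ 2 + p * P * b 0 + p * ⟪Λ, σ 0⟫
        < f v + (1 / 2) * p * (p - 1) * P * ‖σ v‖ ^ 2 + p * P * b v + p * ⟪Λ, σ v⟫ := by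
    intro v hv hfv
    have hb0 := (abs_le.mp (abs_drift_le hp0 hM hP hPM (hb 0 h0))).2
    have hbv := (abs_le.mp (abs_drift_le hp0 hM hP hPM (hb v hv))).1
    have hi0 := (abs_le.mp (abs_mul_inner_le hp0.le Λ (σ 0) (hσ 0 h0))).2
    have hiv := (abs_le.mp (abs_mul_inner_le hp0.le Λ (σ v) (hσ v hv))).1
    have hq0 : (1 / 2) * p * (p - 1) * P * ‖σ 0‖ ^ 2 ≤ (1 / 2) * p * (p - 1) * M * L ^ 2 := by
      gcongr
      exact hσ 0 h0
    have hqv : 0 ≤ (1 / 2) * p * (p - 1) * P * ‖σ v‖ ^ 2 := by positivity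
    have hpL : 0 < p * L := by positivity
    have hrest : 0 ≤ (3 * K + p * (p - 1) * M * L ^ 2 + 4 * (p * M * L')) * ‖Λ‖ := by positivity
    linarith
  refine ⟨key, fun vhat hvhat hmin => ?_⟩
  by_contra! hlt
  exact absurd (key vhat hvhat hlt) (not_lt.mpr (hmin 0 h0))
end

section
/- Let Γ ⊆ ℝ^m with 0 ∈ Γ, let δ, L, K > 0, 0 < η ≤ M, and p > 1 + 2δ. There exists a constant c' > 0, depending only on δ, L, K, η, M, p, with the following property: for every triple f : Γ → ℝ, b : Γ → ℝ, σ : Γ → ℝ^n satisfying f(v) ≥ 0 and |b(v)| ≤ δ ‖σ(v)‖² + L for all v ∈ Γ, f(0) ≤ K and ‖σ(0)‖ ≤ K; for every P ∈ [η, M] and Λ ∈ ℝ^n; and for every v ∈ Γ with ‖σ(v)‖ > c' (1 + ‖Λ‖), one has G(v, P, Λ) > G(0, P, Λ), where G(v, P, Λ) := f(v) + (1/2) p (p−1) P ‖σ(v)‖² + p P b(v) + p ⟨Λ, σ(v)⟩. Consequently, any minimizer v̂ of v ↦ G(v, P, Λ) over Γ satisfies ‖σ(v̂)‖ ≤ c'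 (1 + ‖Λ‖). -/
open RealInnerProductSpace

/-- in the singular case (`|b(v)| ≤ δ‖σ(v)‖² + L`, `f ≥ 0` on `Γ`,
`f(0) ≤ K`, `‖σ(0)‖ ≤ K`, `η ≤ P ≤ M`, `p > 1 + 2δ`), there is a constant
`c' > 0` depending only on `δ, L, K, η, M, p` such that the Hamiltonian
`G(v,P,Λ) = f(v) + ½p(p−1)P‖σ(v)‖² + pPb(v) + p⟨Λ,σ(v)⟩` satisfies
`G(v,P,Λ) > G(0,P,Λ)` whenever `‖σ(v)‖ > c'(1+‖Λ‖)`; consequently any minimizer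
`v̂` of `G(·,P,Λ)` over `Γ` satisfies `‖σ(v̂)‖ ≤ c'(1+‖Λ‖)`. -/
theorem singular_case_minimizer_bound {m n : ℕ}
    (Γ : Set (EuclideanSpace ℝ (Fin m))) (h0 : (0 : EuclideanSpace ℝ (Fin m)) ∈ Γ)
    (δ L K η M p : ℝ) (hδ : 0 < δ) (hL : 0 < L) (hK : 0 < K)
    (hη : 0 < η) (hηM : η ≤ M) (hp : 1 + 2 * δ < p) :
    ∃ c' : ℝ, 0 < c' ∧
      ∀ (f b : EuclideanSpace ℝ (Fin m) → ℝ)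
        (σ : EuclideanSpace ℝ (Fin m) → EuclideanSpace ℝ (Fin n)),
        (∀ v ∈ Γ, 0 ≤ f v) →
        (∀ v ∈ Γ, |b v| ≤ δ * ‖σ v‖ ^ 2 + L) →
        f 0 ≤ K → ‖σ 0‖ ≤ K →
        ∀ P : ℝ, η ≤ P → P ≤ M →
        ∀ Λ : EuclideanSpace ℝ (Fin n),
          (∀ v ∈ Γ, c' * (1 + ‖Λ‖) < ‖σ v‖ →
            f 0 + (1 / 2) * p * (p - 1) * P * ‖σ 0‖ ^ 2 + p * P * b 0 + p * ⟪Λ, σ 0⟫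
              < f v + (1 / 2) * p * (p - 1) * P * ‖σ v‖ ^ 2 + p * P * b v + p * ⟪Λ, σ v⟫) ∧
          (∀ vhat ∈ Γ,
            (∀ v ∈ Γ,
              f vhat + (1 / 2) * p * (p - 1) * P * ‖σ vhat‖ ^ 2 + p * P * b vhat
                  + p * ⟪Λ, σ vhat⟫
                ≤ f v + (1 / 2) * p * (p - 1) * P * ‖σ v‖ ^ 2 + p * P * b v + p * ⟪Λ, σ v⟫) →
            ‖σ vhat‖ ≤ c' * (1 + ‖Λ‖)) := by
  have hp1 : 0 < p - 1 := by linarith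
  have hp0 : 0 < p := by linarith
  have hM : 0 < M := hη.trans_le hηM
  set a : ℝ := p * (p - 1 - 2 * δ) / 2 with ha_def
  have ha : 0 < a := by
    have : 0 < p - 1 - 2 * δ := by linarith
    positivity
  set A : ℝ := K + (1 / 2) * p * (p - 1) * M * K ^ 2 + p * M * (δ * K ^ 2 + L) with hA_def
  have hA : 0 < A := by positivity
  set B : ℝ := A + p * K + p * M * L with hB_def
  have hB : 0 < B := by positivity
  set c : ℝ := (p + B) / (a * η) + 1 with hc_def
  have hc1 : 1 ≤ c := by
    have : 0 ≤ (p + B) / (a * η) := by positivity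
    linarith
  have hcB : p + B ≤ a * η * c := by
    have h : a * η * c = p + B + a * η := by
      rw [hc_def]
      field_simp
    have : 0 < a * η := by positivity
    linarith
  refine ⟨c, by linarith, fun f b σ hf hb hf0 hσ0 P hPη hPM Λ => ?_⟩
  have hP : 0 < P := hη.trans_le hPη
  have hΛ : 0 ≤ ‖Λ‖ := norm_nonneg Λ
  have key : ∀ v ∈ Γ, c * (1 + ‖Λ‖) < ‖σ v‖ →
      f 0 + (1 / 2) * p * (p - 1) * P * ‖σ 0‖ ^ 2 + p * P * b 0 + p * ⟪Λ, σ 0⟫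
        < f v + (1 / 2) * p * (p - 1) * P * ‖σ v‖ ^ 2 + p * P * b v + p * ⟪Λ, σ v⟫ := by
    intro v hv hs
    have upper : f 0 + (1 / 2) * p * (p - 1) * P * ‖σ 0‖ ^ 2 + p * P * b 0 + p * ⟪Λ, σ 0⟫
        ≤ A + p * (‖Λ‖ * K) := by
      have hb0 : b 0 ≤ δ * K ^ 2 + L :=
        calc b 0 ≤ δ * ‖σ 0‖ ^ 2 + L := (le_abs_self _).trans (hb 0 h0)
          _ ≤ δ * K ^ 2 + L := by gcongr
      have h1 : (1 / 2) * p * (p - 1) * P * ‖σ 0‖ ^ 2 ≤ (1 / 2) * p * (p - 1) * M * K ^ 2 := by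
        gcongr
      have h2 : p * P * b 0 ≤ p * M * (δ * K ^ 2 + L) :=
        calc p * P * b 0 ≤ p * P * (δ * K ^ 2 + L) := by gcongr
          _ ≤ p * M * (δ * K ^ 2 + L) := by gcongr
      have h3 : p * ⟪Λ, σ 0⟫ ≤ p * (‖Λ‖ * K) := by
        have := real_inner_le_norm Λ (σ 0)
        gcongr
        exact this.trans (by gcongr)
      linarith
    have lower : a * η * ‖σ v‖ ^ 2 - p * M * L - p * (‖Λ‖ * ‖σ v‖)
        ≤ f v + (1 / 2) * p * (p - 1) * P * ‖σ v‖ ^ 2 + p * P * b v + p * ⟪Λ, σ v⟫ := by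
      have h1 : p * P * (-(δ * ‖σ v‖ ^ 2 + L)) ≤ p * P * b v := by
        have := (abs_le.mp (hb v hv)).1
        gcongr
      have h2 : p * (-(‖Λ‖ * ‖σ v‖)) ≤ p * ⟪Λ, σ v⟫ := by
        have := (abs_le.mp (abs_real_inner_le_norm Λ (σ v))).1
        gcongr
      have h3 : a * η * ‖σ v‖ ^ 2 ≤ a * P * ‖σ v‖ ^ 2 := by gcongr
      have h4 : p * P * L ≤ p * M * L := by gcongr
      have h5 : a * P * ‖σ v‖ ^ 2
          = (1 / 2) * p * (p - 1) * P * ‖σ v‖ ^ 2 - p * P * (δ * ‖σ v‖ ^ 2) := by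
        rw [ha_def]
        ring
      linarith [hf v hv]
    have hs1 : 1 ≤ ‖σ v‖ := by nlinarith
    have h1 : (p + B) * (1 + ‖Λ‖) * ‖σ v‖ < a * η * ‖σ v‖ ^ 2 :=
      calc (p + B) * (1 + ‖Λ‖) * ‖σ v‖ ≤ a * η * c * (1 + ‖Λ‖) * ‖σ v‖ := by gcongr
        _ = a * η * ‖σ v‖ * (c * (1 + ‖Λ‖)) := by ring
        _ < a * η * ‖σ v‖ * ‖σ v‖ := by gcongr
        _ = a * η * ‖σ v‖ ^ 2 := by ring
    have h2 : B * (1 + ‖Λ‖) ≤ B * (1 + ‖Λ‖) * ‖σ v‖ :=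
      le_mul_of_one_le_right (by positivity) hs1
    have h3 : A + p * (‖Λ‖ * K) + p * M * L ≤ B * (1 + ‖Λ‖) := by
      have : 0 ≤ A * ‖Λ‖ + p * K + p * M * L * ‖Λ‖ := by positivity
      rw [hB_def]
      linarith
    have h4 : 0 ≤ p * ‖σ v‖ := by positivity
    linarith
  refine ⟨key, fun w hw hmin => ?_⟩
  by_contra! hlt
  exact (key w hw hlt).not_ge (hmin 0 h0)
end

section
/- Let Γ ⊆ ℝ^m be a cone with 0 ∈ Γ and let p > 1. Let b : ℝ × Γ → ℝ and σ : ℝ × Γ → ℝ^n be homogeneous of degree 1 on the cone ℝ × Γ, and let f : ℝ × Γ → ℝ be homogeneous of degree p on ℝ × Γ with f(x,u) ≥ 0 for all (x,u). Fix P₁, P₂ ∈ ℝ and Λ₁, Λ₂ ∈ ℝ^n, and define G₁(v) := f(1,v) + (1/2)p(p−1)P₁‖σ(1,v)‖² + pP₁ b(1,v) + p⟨Λ₁, σ(1,v)⟩ and G₂(v) := f(−1,v) + (1/2)p(p−1)P₂‖σ(−1,v)‖² − pP₂ b(−1,v) − p⟨Λ₂, σ(−1,v)⟩ for v ∈ Γ,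 and assume both { G₁(v) : v ∈ Γ } and { G₂(v) : v ∈ Γ } are bounded below; set G₁* := inf_{v∈Γ} G₁(v) and G₂* := inf_{v∈Γ} G₂(v). Then for every x ∈ ℝ and u ∈ Γ: f(x,u) + 1_{x>0} [ (1/2)p(p−1)P₁ x^{p−2} ‖σ(x,u)‖² − x^p G₁* + p x^{p−1} ( P₁ b(x,u) + ⟨Λ₁, σ(x,u)⟩ ) ] + 1_{x<0} [ (1/2)p(p−1)P₂ (−x)^{p−2} ‖σ(x,u)‖² − (−x)^p G₂* − p (−x)^{p−1} ( P₂ b(x,u) + ⟨Λ₂, σ(x,u)⟩ ) ] ≥ 0. -/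
open RealInnerProductSpace

/-- The degree-`p` expression built from homogeneous data at `(r * e, u)` is `r ^ p` times its value
at `(e, r⁻¹ • u)`, so it is nonnegative once a lower bound for the latter over `Γ` is subtracted. -/
theorem nonneg_of_homogeneous_of_lower_bound {E F : Type*} [AddCommGroup E] [Module ℝ E]
    [NormedAddCommGroup F] [InnerProductSpace ℝ F] {Γ : Set E}
    (hcone : ∀ l : ℝ, 0 < l → ∀ u ∈ Γ, l • u ∈ Γ) {p : ℝ}
    {b : ℝ → E → ℝ} {σ : ℝ → E → F} {f : ℝ → E → ℝ}
    (hb : ∀ l : ℝ, 0 < l → ∀ x : ℝ, ∀ u ∈ Γ, b (l * x) (l • u) = l * b x u)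
    (hσ : ∀ l : ℝ, 0 < l → ∀ x : ℝ, ∀ u ∈ Γ, σ (l * x) (l • u) = l • σ x u)
    (hf : ∀ l : ℝ, 0 < l → ∀ x : ℝ, ∀ u ∈ Γ, f (l * x) (l • u) = l ^ p * f x u)
    {c d e g : ℝ} {P : ℝ} {Λ : F}
    (hg : ∀ v ∈ Γ, g ≤ f e v + c * ‖σ e v‖ ^ 2 + d * (P * b e v + ⟪Λ, σ e v⟫))
    {r : ℝ} (hr : 0 < r) {u : E} (hu : u ∈ Γ) :
    0 ≤ f (r * e) u + c * r ^ (p - 2) * ‖σ (r * e) u‖ ^ 2 - r ^ p * g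
      + d * r ^ (p - 1) * (P * b (r * e) u + ⟪Λ, σ (r * e) u⟫) := by
  have hv : r⁻¹ • u ∈ Γ := hcone _ (inv_pos.2 hr) u hu
  obtain ⟨v, hvΓ, rfl⟩ : ∃ v ∈ Γ, r • v = u := ⟨_, hv, smul_inv_smul₀ hr.ne' u⟩
  have h1 : r ^ p = r ^ (p - 1) * r := by
    rw [← Real.rpow_add_one hr.ne', sub_add_cancel]
  have h2 : r ^ p = r ^ (p - 2) * r ^ 2 := by
    rw [← Real.rpow_add_natCast hr.ne']; norm_num
  rw [hb r hr _ v hvΓ, hσ r hr _ v hvΓ, hf r hr _ v hvΓ, norm_smul, Real.norm_of_nonneg hr.le,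
    real_inner_smul_right]
  have key := mul_nonneg (Real.rpow_pos_of_pos hr p).le (sub_nonneg.2 (hg v hvΓ))
  linear_combination key + c * ‖σ e v‖ ^ 2 * h2 + d * (P * b e v + ⟪Λ, σ e v⟫) * h1

/-- pointwise nonnegativity of the function `φ_t(x,u)` in the
verification argument: for homogeneous data `b, σ` (degree 1) and `f ≥ 0`
(degree `p > 1`) on the cone `ℝ × Γ`, and `G₁* = inf_Γ G₁`, `G₂* = inf_Γ G₂`
the drivers' infima, one has for all `x ∈ ℝ`, `u ∈ Γ`:
`f(x,u) + 1_{x>0}[½p(p−1)P₁x^{p−2}‖σ(x,u)‖² − x^p G₁* + px^{p−1}(P₁b(x,u)+⟨Λ₁,σ(x,u)⟩)]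
 + 1_{x<0}[½p(p−1)P₂(−x)^{p−2}‖σ(x,u)‖² − (−x)^p G₂* − p(−x)^{p−1}(P₂b(x,u)+⟨Λ₂,σ(x,u)⟩)] ≥ 0`. -/
theorem verification_pointwise_nonneg {m n : ℕ}
    (Γ : Set (EuclideanSpace ℝ (Fin m)))
    (hcone : ∀ l : ℝ, 0 < l → ∀ u ∈ Γ, l • u ∈ Γ)
    (h0 : (0 : EuclideanSpace ℝ (Fin m)) ∈ Γ)
    (p : ℝ) (hp : 1 < p)
    (b : ℝ → EuclideanSpace ℝ (Fin m) → ℝ)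
    (σ : ℝ → EuclideanSpace ℝ (Fin m) → EuclideanSpace ℝ (Fin n))
    (f : ℝ → EuclideanSpace ℝ (Fin m) → ℝ)
    (hb : ∀ l : ℝ, 0 < l → ∀ x : ℝ, ∀ u ∈ Γ, b (l * x) (l • u) = l * b x u)
    (hσ : ∀ l : ℝ, 0 < l → ∀ x : ℝ, ∀ u ∈ Γ, σ (l * x) (l • u) = l • σ x u)
    (hf : ∀ l : ℝ, 0 < l → ∀ x : ℝ, ∀ u ∈ Γ, f (l * x) (l • u) = l ^ p * f x u)
    (hfpos : ∀ x : ℝ, ∀ u ∈ Γ, 0 ≤ f x u)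
    (P₁ P₂ : ℝ) (Λ₁ Λ₂ : EuclideanSpace ℝ (Fin n))
    (G₁ G₂ : EuclideanSpace ℝ (Fin m) → ℝ)
    (hG₁ : ∀ v, G₁ v = f 1 v + (1 / 2) * p * (p - 1) * P₁ * ‖σ 1 v‖ ^ 2
        + p * P₁ * b 1 v + p * ⟪Λ₁, σ 1 v⟫)
    (hG₂ : ∀ v, G₂ v = f (-1) v + (1 / 2) * p * (p - 1) * P₂ * ‖σ (-1) v‖ ^ 2
        - p * P₂ * b (-1) v - p * ⟪Λ₂, σ (-1) v⟫)
    (hbdd₁ : BddBelow (G₁ '' Γ)) (hbdd₂ : BddBelow (G₂ '' Γ))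
    (G₁star G₂star : ℝ)
    (hG₁star : G₁star = sInf (G₁ '' Γ)) (hG₂star : G₂star = sInf (G₂ '' Γ))
    (x : ℝ) (u : EuclideanSpace ℝ (Fin m)) (hu : u ∈ Γ) :
    0 ≤ f x u
      + (if 0 < x then
          (1 / 2) * p * (p - 1) * P₁ * x ^ (p - 2) * ‖σ x u‖ ^ 2 - x ^ p * G₁star
            + p * x ^ (p - 1) * (P₁ * b x u + ⟪Λ₁, σ x u⟫)
        else 0)
      + (if x < 0 then
          (1 / 2) * p * (p - 1) * P₂ * (-x) ^ (p - 2) * ‖σ x u‖ ^ 2 - (-x) ^ p * G₂star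
            - p * (-x) ^ (p - 1) * (P₂ * b x u + ⟪Λ₂, σ x u⟫)
        else 0) := by
  rcases lt_trichotomy x 0 with hx | rfl | hx
  · have h := nonneg_of_homogeneous_of_lower_bound hcone hb hσ hf
      (c := (1 / 2) * p * (p - 1) * P₂) (d := -p) (e := -1) (g := G₂star) (P := P₂) (Λ := Λ₂)
      (fun v hv => by
        have := csInf_le hbdd₂ (Set.mem_image_of_mem G₂ hv)
        rw [← hG₂star, hG₂] at this
        linarith) (neg_pos.2 hx) hu
    rw [neg_mul_neg, mul_one] at h
    rw [if_neg hx.not_gt, if_pos hx]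
    linarith
  · simpa using hfpos 0 u hu
  · have h := nonneg_of_homogeneous_of_lower_bound hcone hb hσ hf
      (c := (1 / 2) * p * (p - 1) * P₁) (d := p) (e := 1) (g := G₁star) (P := P₁) (Λ := Λ₁)
      (fun v hv => by
        have := csInf_le hbdd₁ (Set.mem_image_of_mem G₁ hv)
        rw [← hG₁star, hG₁] at this
        linarith) hx hu
    rw [mul_one] at h
    rw [if_pos hx, if_neg hx.not_gt]
    linarith
end
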